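/- Let L : ℝⁿ × ℝⁿ → ℝ be continuous, convex in v for each x (L5), satisfy the quadratic bounds A⁻¹|v|² − B ≤ L(x,v) ≤ A|v|² + B for all (x,v) (L7), and let u(x) = inf_{η ∈ A_x} ∫₀^∞ e^{−s} L(η(s), −η̇(s)) ds be the value function on ℝⁿ. Let x ∈ ℝⁿ and let η ∈ A_x be a minimizer, i.e. u(x) = ∫₀^∞ e^{−s} L(η(s), −η̇(s)) ds. Then for every t > 0: (i) u(x) = ∫₀ᵗ e^{−s} L(η(s), −η̇(s)) ds + e^{−t} u(η(t)); (ii) u(η(t)) = eᵗ ∫ₜ^∞ e^{−s} L(η(s), −η̇(s)) ds; and (iii) for every h > 0, e^{−t} u(η(t)) = ∫ₜ^{t+h} e^{−s} L(η(s), −η̇(s)) ds + e^{−(t+h)} u(η(t+h)). -/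

import Mathlib

open Metric Set MeasureTheory Filter
open scoped Topology NNReal RealInnerProductSpace

noncomputable section

abbrev Euc (n : ℕ) := EuclideanSpace ℝ (Fin n)

/-- `v` is a viscosity subsolution of `v + H(x, Dv) = 0` in the open set `Ω`. -/
def IsViscositySubsolutionIn {n : ℕ} (Ω : Set (Euc n)) (H : Euc n → Euc n → ℝ)
    (v : Euc n → ℝ) : Prop :=
  ∀ x ∈ Ω, ∀ φ : Euc n → ℝ, ContDiff ℝ 1 φ →
    IsLocalMaxOn (fun y => v y - φ y) Ω x → v x + H x (gradient φ x) ≤ 0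

/-- `v` is a viscosity supersolution of `v + H(x, Dv) = 0` on the closure of `Ω`. -/
def IsViscositySupersolutionOn {n : ℕ} (Ω : Set (Euc n)) (H : Euc n → Euc n → ℝ)
    (v : Euc n → ℝ) : Prop :=
  ∀ x ∈ closure Ω, ∀ φ : Euc n → ℝ, ContDiff ℝ 1 φ →
    IsLocalMinOn (fun y => v y - φ y) (closure Ω) x → 0 ≤ v x + H x (gradient φ x)

/-- `v` is a state-constraint viscosity solution on `Ω`. -/
def IsStateConstraintSolution {n : ℕ} (Ω : Set (Euc n)) (H : Euc n → Euc n → ℝ)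
    (v : Euc n → ℝ) : Prop :=
  ContinuousOn v (closure Ω) ∧ IsViscositySubsolutionIn Ω H v ∧
    IsViscositySupersolutionOn Ω H v

/-- Admissible curve/velocity pairs: `p.1` is the curve, `p.2` its (locally integrable)
velocity; the curve starts at `x`, stays in the closure of `Ω`, and has integrable cost. -/
def Curves {n : ℕ} (Ω : Set (Euc n)) (L : Euc n → Euc n → ℝ) (x : Euc n) :
    Set ((ℝ → Euc n) × (ℝ → Euc n)) :=
  {p | (∀ t : ℝ, 0 ≤ t → IntegrableOn p.2 (Icc 0 t) volume) ∧
    (∀ t : ℝ, 0 ≤ t → p.1 t = x + ∫ s in Icc (0:ℝ) t, p.2 s) ∧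
    (∀ t : ℝ, 0 ≤ t → p.1 t ∈ closure Ω) ∧
    IntegrableOn (fun s => Real.exp (-s) * L (p.1 s) (-p.2 s)) (Ioi (0:ℝ)) volume}

/-- The cost functional `J[x, η] = ∫₀^∞ e^{-s} L(η(s), -η̇(s)) ds`. -/
def costJ {n : ℕ} (L : Euc n → Euc n → ℝ) (p : (ℝ → Euc n) × (ℝ → Euc n)) : ℝ :=
  ∫ s in Ioi (0:ℝ), Real.exp (-s) * L (p.1 s) (-p.2 s)

/-- The value function `u(x) = inf_{η ∈ A_x} J[x, η]`. -/
def valueFun {n : ℕ} (Ω : Set (Euc n)) (L : Euc n → Euc n → ℝ) (x : Euc n) : ℝ :=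
  sInf (costJ L '' Curves Ω L x)

section Helpers

variable {E : Type*} [NormedAddCommGroup E] [NormedSpace ℝ E]

theorem shift_integrableOn (f : ℝ → E) (S : Set ℝ) (c : ℝ) :
    IntegrableOn (fun s => f (s + c)) ((fun s => s + c) ⁻¹' S) volume ↔ IntegrableOn f S volume :=
  (measurePreserving_add_right volume c).integrableOn_comp_preimage
    (measurableEmbedding_addRight c)

theorem shift_setIntegral (f : ℝ → E) (S : Set ℝ) (c : ℝ) :
    ∫ s in (fun s => s + c) ⁻¹' S, f (s + c) = ∫ s in S, f s :=
  (measurePreserving_add_right volume c).setIntegral_preimage_emb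
    (measurableEmbedding_addRight c) f S

theorem preIoc (a b c : ℝ) : (fun s => s + c) ⁻¹' (Ioc a b) = Ioc (a - c) (b - c) := by
  simp

theorem preIoi (a c : ℝ) : (fun s => s + c) ⁻¹' (Ioi a) = Ioi (a - c) := by
  simp

end Helpers

theorem cost_lower {n : ℕ} (L : Euc n → Euc n → ℝ) (B : ℝ)
    (hL : ∀ x v : Euc n, -B ≤ L x v) (x : Euc n) :
    BddBelow (costJ L '' Curves univ L x) := by
  refine ⟨∫ s in Ioi (0:ℝ), Real.exp (-s) * (-B), ?_⟩
  rintro _ ⟨q, hq, rfl⟩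
  refine setIntegral_mono ?_ hq.2.2.2 ?_
  · exact (integrableOn_exp_neg_Ioi 0).mul_const _
  · intro s
    exact mul_le_mul_of_nonneg_left (hL _ _) (Real.exp_pos _).le

theorem tail_mem {n : ℕ} (L : Euc n → Euc n → ℝ) (x : Euc n)
    (p : (ℝ → Euc n) × (ℝ → Euc n)) (hp : p ∈ Curves univ L x) (t : ℝ) (ht : 0 < t) :
    ((fun s => p.1 (s + t), fun s => p.2 (s + t)) : (ℝ → Euc n) × (ℝ → Euc n))
      ∈ Curves univ L (p.1 t) ∧
    costJ L (fun s => p.1 (s + t), fun s => p.2 (s + t)) =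
      Real.exp t * ∫ s in Ioi t, Real.exp (-s) * L (p.1 s) (-p.2 s) := by
  obtain ⟨h1, h2, -, h4⟩ := hp
  have e : (fun s => Real.exp (-s) * L (p.1 (s + t)) (-p.2 (s + t))) =
      fun s => Real.exp t * (Real.exp (-(s + t)) * L (p.1 (s + t)) (-p.2 (s + t))) := by
    funext s
    rw [← mul_assoc, ← Real.exp_add]
    congr 2; ring
  refine ⟨⟨?_, ?_, ?_, ?_⟩, ?_⟩
  · intro s hs
    rw [integrableOn_Icc_iff_integrableOn_Ioc]
    have := shift_integrableOn p.2 (Ioc t (s + t)) t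
    rw [preIoc, sub_self, add_sub_cancel_right] at this
    exact this.2 ((h1 (s + t) (by linarith)).mono_set
      (fun y hy => ⟨by linarith [hy.1], hy.2⟩))
  · intro s hs
    have := shift_setIntegral p.2 (Ioc t (s + t)) t
    rw [preIoc, sub_self, add_sub_cancel_right] at this
    simp only
    rw [integral_Icc_eq_integral_Ioc, this, h2 (s + t) (by linarith), h2 t ht.le,
      integral_Icc_eq_integral_Ioc, integral_Icc_eq_integral_Ioc, add_assoc,
      ← setIntegral_union (Ioc_disjoint_Ioc_of_le le_rfl) measurableSet_Ioc,
      Ioc_union_Ioc_eq_Ioc ht.le (by linarith)]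
    · exact (h1 t ht.le).mono_set Ioc_subset_Icc_self
    · exact (h1 (s + t) (by linarith)).mono_set (fun y hy => ⟨by linarith [hy.1], hy.2⟩)
  · intro s _; simp
  · simp only
    rw [e]
    refine Integrable.const_mul ?_ _
    have := shift_integrableOn (fun s => Real.exp (-s) * L (p.1 s) (-p.2 s)) (Ioi t) t
    rw [preIoi, sub_self] at this
    exact this.2 (h4.mono_set (Ioi_subset_Ioi ht.le))
  · have := shift_setIntegral (fun s => Real.exp (-s) * L (p.1 s) (-p.2 s)) (Ioi t) t
    rw [preIoi, sub_self] at this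
    unfold costJ
    simp only
    rw [e, integral_const_mul, this]

theorem concat_mem {n : ℕ} (L : Euc n → Euc n → ℝ) (x : Euc n)
    (p q : (ℝ → Euc n) × (ℝ → Euc n)) (hp : p ∈ Curves univ L x) (t : ℝ) (ht : 0 < t)
    (hq : q ∈ Curves univ L (p.1 t)) :
    ∃ r ∈ Curves univ L x, costJ L r =
      (∫ s in Ioc (0:ℝ) t, Real.exp (-s) * L (p.1 s) (-p.2 s)) + Real.exp (-t) * costJ L q := by
  obtain ⟨h1, h2, -, h4⟩ := hp
  obtain ⟨k1, k2, -, k4⟩ := hq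
  obtain ⟨r, hr⟩ : ∃ r : (ℝ → Euc n) × (ℝ → Euc n),
      r = (fun s => if s ≤ t then p.1 s else q.1 (s + -t),
        fun s => if s ≤ t then p.2 s else q.2 (s + -t)) := ⟨_, rfl⟩
  have a1 : ∀ s, s ≤ t → r.1 s = p.1 s := fun s h => by simp [hr, h]
  have a2 : ∀ s, s ≤ t → r.2 s = p.2 s := fun s h => by simp [hr, h]
  have b1 : ∀ s, t < s → r.1 s = q.1 (s + -t) := fun s h => by simp [hr, not_le.2 h]
  have b2 : ∀ s, t < s → r.2 s = q.2 (s + -t) := fun s h => by simp [hr, not_le.2 h]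
  have hl : ∀ s, s ≤ t → IntegrableOn r.2 (Ioc 0 s) volume := by
    intro s hs
    rcases le_total s 0 with h0 | h0
    · simp [Ioc_eq_empty (not_lt.2 h0)]
    refine IntegrableOn.congr_fun ((h1 s h0).mono_set Ioc_subset_Icc_self) ?_ measurableSet_Ioc
    intro y hy; exact (a2 y (hy.2.trans hs)).symm
  have hl' : ∀ s, s ≤ t → ∫ y in Ioc 0 s, r.2 y = ∫ y in Ioc 0 s, p.2 y := by
    intro s hs
    exact setIntegral_congr_fun measurableSet_Ioc (fun y hy => a2 y (hy.2.trans hs))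
  have hg : ∀ s, t ≤ s → IntegrableOn r.2 (Ioc t s) volume := by
    intro s hs
    have := shift_integrableOn q.2 (Ioc 0 (s - t)) (-t)
    rw [preIoc, sub_neg_eq_add, sub_neg_eq_add, zero_add, sub_add_cancel] at this
    refine IntegrableOn.congr_fun
      (this.2 ((k1 (s - t) (by linarith)).mono_set Ioc_subset_Icc_self)) ?_ measurableSet_Ioc
    intro y hy; exact (b2 y hy.1).symm
  have hg' : ∀ s, t ≤ s → ∫ y in Ioc t s, r.2 y = ∫ y in Ioc 0 (s - t), q.2 y := by
    intro s hs
    have := shift_setIntegral q.2 (Ioc 0 (s - t)) (-t)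
    rw [preIoc, sub_neg_eq_add, sub_neg_eq_add, zero_add, sub_add_cancel] at this
    rw [← this]
    exact setIntegral_congr_fun measurableSet_Ioc (fun y hy => b2 y hy.1)
  have cl : IntegrableOn (fun s => Real.exp (-s) * L (r.1 s) (-r.2 s)) (Ioc 0 t) volume := by
    refine IntegrableOn.congr_fun (h4.mono_set Ioc_subset_Ioi_self) ?_ measurableSet_Ioc
    intro y hy; simp only; rw [a1 y hy.2, a2 y hy.2]
  have e : ∀ s, Real.exp (-t) * (Real.exp (-(s + -t)) * L (q.1 (s + -t)) (-q.2 (s + -t))) =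
      Real.exp (-s) * L (q.1 (s + -t)) (-q.2 (s + -t)) := by
    intro s
    rw [← mul_assoc, ← Real.exp_add]
    congr 2; ring
  have cg : IntegrableOn (fun s => Real.exp (-s) * L (r.1 s) (-r.2 s)) (Ioi t) volume := by
    have := shift_integrableOn (fun s => Real.exp (-s) * L (q.1 s) (-q.2 s)) (Ioi 0) (-t)
    rw [preIoi, sub_neg_eq_add, zero_add] at this
    refine IntegrableOn.congr_fun ((this.2 k4).const_mul (Real.exp (-t))) ?_ measurableSet_Ioi
    intro y hy; simp only; rw [b1 y hy, b2 y hy, e]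
  have hu : Ioc 0 t ∪ Ioi t = Ioi (0:ℝ) := Ioc_union_Ioi_eq_Ioi ht.le
  refine ⟨r, ⟨?_, ?_, ?_, ?_⟩, ?_⟩
  · intro s hs
    rw [integrableOn_Icc_iff_integrableOn_Ioc]
    rcases le_total s t with h | h
    · exact hl s h
    · rw [← Ioc_union_Ioc_eq_Ioc ht.le h]
      exact (hl t le_rfl).union (hg s h)
  · intro s hs
    rw [integral_Icc_eq_integral_Ioc]
    rcases le_or_gt s t with h | h
    · rw [hl' s h, a1 s h, h2 s hs, integral_Icc_eq_integral_Ioc]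
    · rw [← Ioc_union_Ioc_eq_Ioc ht.le h.le,
        setIntegral_union (Ioc_disjoint_Ioc_of_le le_rfl) measurableSet_Ioc (hl t le_rfl)
          (hg s h.le), hl' t le_rfl, hg' s h.le, b1 s h, ← sub_eq_add_neg,
        k2 (s - t) (by linarith), h2 t ht.le,
        integral_Icc_eq_integral_Ioc, integral_Icc_eq_integral_Ioc, add_assoc]
  · intro s _; simp
  · rw [← hu]; exact cl.union cg
  · unfold costJ
    rw [← hu, setIntegral_union Ioc_disjoint_Ioi_same measurableSet_Ioi cl cg, hu]
    congr 1
    · refine setIntegral_congr_fun measurableSet_Ioc ?_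
      intro y hy; simp only; rw [a1 y hy.2, a2 y hy.2]
    · have := shift_setIntegral (fun s => Real.exp (-s) * L (q.1 s) (-q.2 s)) (Ioi 0) (-t)
      rw [preIoi, sub_neg_eq_add, zero_add] at this
      rw [← this, ← integral_const_mul]
      refine setIntegral_congr_fun measurableSet_Ioi ?_
      intro y hy; simp only; rw [b1 y hy, b2 y hy, e]

/-- Lemma 5.10: dynamic programming identities along a minimizer. -/
theorem minimizer_dpp_identities {n : ℕ}
    (L : Euc n → Euc n → ℝ) (hLcont : Continuous (Function.uncurry L))
    (hL5 : ∀ x : Euc n, ConvexOn ℝ univ (L x))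
    (A B : ℝ) (hA : 0 < A) (hB : 0 < B)
    (hL7 : ∀ x v : Euc n, A⁻¹ * ‖v‖ ^ 2 - B ≤ L x v ∧ L x v ≤ A * ‖v‖ ^ 2 + B)
    (x : Euc n) (p : (ℝ → Euc n) × (ℝ → Euc n)) (hp : p ∈ Curves univ L x)
    (hmin : costJ L p = valueFun univ L x) :
    ∀ t : ℝ, 0 < t →
      (valueFun univ L x = (∫ s in Ioc (0:ℝ) t, Real.exp (-s) * L (p.1 s) (-p.2 s)) +
        Real.exp (-t) * valueFun univ L (p.1 t)) ∧
      (valueFun univ L (p.1 t) =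
        Real.exp t * ∫ s in Ioi t, Real.exp (-s) * L (p.1 s) (-p.2 s)) ∧
      (∀ h : ℝ, 0 < h →
        Real.exp (-t) * valueFun univ L (p.1 t) =
          (∫ s in Ioc t (t + h), Real.exp (-s) * L (p.1 s) (-p.2 s)) +
            Real.exp (-(t + h)) * valueFun univ L (p.1 (t + h))) := by
  have hlow : ∀ x v : Euc n, -B ≤ L x v := fun x v => by
    have h1 := (hL7 x v).1
    have h2 : 0 ≤ A⁻¹ * ‖v‖ ^ 2 := by positivity
    linarith
  have split : ∀ t, 0 < t → costJ L p =
      (∫ s in Ioc (0:ℝ) t, Real.exp (-s) * L (p.1 s) (-p.2 s)) +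
        ∫ s in Ioi t, Real.exp (-s) * L (p.1 s) (-p.2 s) := by
    intro t ht
    unfold costJ
    rw [← Ioc_union_Ioi_eq_Ioi ht.le,
      setIntegral_union Ioc_disjoint_Ioi_same measurableSet_Ioi
        (hp.2.2.2.mono_set Ioc_subset_Ioi_self) (hp.2.2.2.mono_set (Ioi_subset_Ioi ht.le))]
  have key : ∀ t, 0 < t → valueFun univ L (p.1 t) =
      Real.exp t * ∫ s in Ioi t, Real.exp (-s) * L (p.1 s) (-p.2 s) := by
    intro t ht
    obtain ⟨hm, hc⟩ := tail_mem L x p hp t ht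
    apply le_antisymm
    · rw [← hc]
      exact csInf_le (cost_lower L B hlow _) ⟨_, hm, rfl⟩
    · refine le_csInf ⟨_, _, hm, rfl⟩ ?_
      rintro _ ⟨q, hq, rfl⟩
      obtain ⟨r, hr, hrc⟩ := concat_mem L x p q hp t ht hq
      have h1 : valueFun univ L x ≤ costJ L r :=
        csInf_le (cost_lower L B hlow _) ⟨_, hr, rfl⟩
      rw [← hmin, split t ht, hrc] at h1
      have h2 := mul_le_mul_of_nonneg_left (le_of_add_le_add_left h1) (Real.exp_pos t).le
      rwa [← mul_assoc, ← Real.exp_add, add_neg_cancel, Real.exp_zero, one_mul] at h2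
  have key' : ∀ t, 0 < t → Real.exp (-t) * valueFun univ L (p.1 t) =
      ∫ s in Ioi t, Real.exp (-s) * L (p.1 s) (-p.2 s) := by
    intro t ht
    rw [key t ht, ← mul_assoc, ← Real.exp_add, neg_add_cancel, Real.exp_zero, one_mul]
  intro t ht
  refine ⟨?_, key t ht, ?_⟩
  · rw [key' t ht, ← hmin, split t ht]
  · intro h hh
    rw [key' t ht, key' (t + h) (by linarith),
      ← Ioc_union_Ioi_eq_Ioi (show t ≤ t + h by linarith),
      setIntegral_union Ioc_disjoint_Ioi_same measurableSet_Ioi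
        (hp.2.2.2.mono_set fun y hy => lt_trans ht hy.1)
        (hp.2.2.2.mono_set (Ioi_subset_Ioi (by linarith)))]
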